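/- arXiv:2403.16775 — 9 statements merged into one kernel-verified Lean document; each statement's English description precedes it below -/
import Mathlib

section
/- Let H be a real Hilbert space, let t₀ ∈ ℝ, let f : H → ℝ be differentiable with gradient ∇f, let γ : [t₀,∞) → ℝ be a function, and let Γ : [t₀,∞) → (0,∞) be differentiable with Γ'(t) = γ(t)Γ(t) − 1 for all t ≥ t₀. Suppose x : [t₀,∞) → H is twice differentiable and satisfies the implicit-Hessian-damped inertial equation ẍ(t) + γ(t)ẋ(t) + ∇f(x(t) + Γ(t)ẋ(t)) = 0 for all t ≥ t₀. Then the function y(t) := x(t) + Γ(t)ẋ(t) is differentiable and satisfies the rescaled gradient flow ẏ(t) = −Γ(t)∇f(y(t)) for all t ≥ t₀. -/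
open Filter MeasureTheory Real

/-- The deterministic core identity of time scaling and averaging: a trajectory of the
inertial system with implicit Hessian-driven damping (geometric damping `β ≡ Γ`, where
`Γ' = γΓ - 1`) produces, via `y = x + Γ ẋ`, a solution of the rescaled gradient flow
`ẏ = -Γ ∇f(y)`. -/
theorem inertial_to_rescaled_gradient_flow
    {H : Type*} [NormedAddCommGroup H] [InnerProductSpace ℝ H] [CompleteSpace H]
    (t₀ : ℝ) (f : H → ℝ) (f' : H → H)
    (hf : ∀ z : H, HasGradientAt f (f' z) z)
    (γ Γ : ℝ → ℝ) (hΓpos : ∀ t ≥ t₀, 0 < Γ t)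
    (hΓ' : ∀ t ≥ t₀, HasDerivAt Γ (γ t * Γ t - 1) t)
    (x x' x'' : ℝ → H)
    (hx : ∀ t ≥ t₀, HasDerivAt x (x' t) t)
    (hx' : ∀ t ≥ t₀, HasDerivAt x' (x'' t) t)
    (heq : ∀ t ≥ t₀, x'' t + γ t • x' t + f' (x t + Γ t • x' t) = 0) :
    ∀ t ≥ t₀, HasDerivAt (fun s => x s + Γ s • x' s)
      ((-(Γ t)) • f' (x t + Γ t • x' t)) t := by
  intro t ht
  have hgrad : f' (x t + Γ t • x' t) = -(x'' t + γ t • x' t) :=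
    eq_neg_of_add_eq_zero_right (heq t ht)
  rw [hgrad]
  convert (hx t ht).fun_add ((hΓ' t ht).fun_smul (hx' t ht)) using 1
  module
end

section
/- Let H be a real Hilbert space, t₀ ∈ ℝ, and a : [t₀,∞) → [0,∞) continuous with ∫_{t₀}^∞ a(u)du = +∞; set A(t) = ∫_{t₀}^t a(u)du. Let y : [t₀,∞) → H be continuous and bounded, let ξ : [t₀,∞) → H satisfy ‖ξ(t)‖ → 0 as t → ∞, and define x(t) = e^{−A(t)} y(t₀) + e^{−A(t)} ∫_{t₀}^t a(u)e^{A(u)} y(u)du + ξ(t). If there is x* ∈ H such that ⟨y(t) − x*, h⟩ → 0 as t → ∞ for every h ∈ H (i.e. y(t) converges weakly to x*), then ⟨x(t) − x*, h⟩ → 0 as t → ∞ for every h ∈ H (i.e. x(t) converges weakly to x*). -/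
open Filter MeasureTheory Real
open scoped RealInnerProductSpace

/-- `u ↦ exp (∫ v in t₀..u, a v)` is a primitive of `u ↦ a u * exp (∫ v in t₀..u, a v)`. -/
theorem integral_mul_exp_primitive {a : ℝ → ℝ} (ha : Continuous a) (t₀ s t : ℝ) :
    ∫ u in s..t, a u * exp (∫ v in t₀..u, a v) =
      exp (∫ v in t₀..t, a v) - exp (∫ v in t₀..s, a v) := by
  have hA : ∀ u, HasDerivAt (fun u => ∫ v in t₀..u, a v) (a u) u := fun u =>
    intervalIntegral.integral_hasDerivAt_right (ha.intervalIntegrable _ _)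
      (ha.stronglyMeasurableAtFilter _ _) ha.continuousAt
  have hAc : Continuous (fun u => ∫ v in t₀..u, a v) :=
    continuous_iff_continuousAt.2 fun u => (hA u).continuousAt
  have hwc : Continuous (fun u => a u * exp (∫ v in t₀..u, a v)) :=
    ha.mul (continuous_exp.comp hAc)
  refine intervalIntegral.integral_eq_sub_of_hasDerivAt (f := fun u => exp (∫ v in t₀..u, a v))
    (fun u _ => ?_) (hwc.intervalIntegrable _ _)
  simpa only [mul_comm] using (hA u).exp

/-- The exponential average of a function vanishing at infinity vanishes at infinity, provided the
nonnegative rate `a` is not integrable. -/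
theorem tendsto_exp_average_zero {a φ : ℝ → ℝ} (ha : Continuous a) (ha0 : ∀ u, 0 ≤ a u)
    (t₀ : ℝ) (hadiv : Tendsto (fun t => ∫ u in t₀..t, a u) atTop atTop)
    (hφc : Continuous φ) (hφ : Tendsto φ atTop (nhds 0)) :
    Tendsto (fun t => exp (-(∫ u in t₀..t, a u)) *
      ∫ u in t₀..t, a u * exp (∫ v in t₀..u, a v) * φ u) atTop (nhds 0) := by
  have hAc : Continuous (fun u => ∫ v in t₀..u, a v) :=
    intervalIntegral.continuous_primitive (fun _ _ => ha.intervalIntegrable _ _) t₀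
  have hwc : Continuous (fun u => a u * exp (∫ v in t₀..u, a v)) :=
    ha.mul (continuous_exp.comp hAc)
  have hE : Tendsto (fun t => exp (-(∫ u in t₀..t, a u))) atTop (nhds 0) :=
    tendsto_exp_neg_atTop_nhds_zero.comp hadiv
  rw [Metric.tendsto_atTop]
  intro ε hε
  obtain ⟨T, hT⟩ := Metric.tendsto_atTop.1 hφ (ε / 2) (by positivity)
  set C := ∫ u in t₀..T, a u * exp (∫ v in t₀..u, a v) * φ u with hC
  have hEC := hE.mul_const |C|
  rw [zero_mul] at hEC
  obtain ⟨S, hS⟩ := Metric.tendsto_atTop.1 hEC (ε / 2) (by positivity)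
  refine ⟨max S T, fun t ht => ?_⟩
  have hTt : T ≤ t := (le_max_right _ _).trans ht
  have hhead := hS t ((le_max_left _ _).trans ht)
  rw [Real.dist_eq, sub_zero] at hhead ⊢
  have hsplit := intervalIntegral.integral_add_adjacent_intervals
    ((hwc.mul hφc).intervalIntegrable (μ := volume) t₀ T)
    ((hwc.mul hφc).intervalIntegrable (μ := volume) T t)
  have htail : |∫ u in T..t, a u * exp (∫ v in t₀..u, a v) * φ u| ≤
      ε / 2 * exp (∫ v in t₀..t, a v) := by
    calc |∫ u in T..t, a u * exp (∫ v in t₀..u, a v) * φ u|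
        ≤ ∫ u in T..t, a u * exp (∫ v in t₀..u, a v) * (ε / 2) := by
          rw [← Real.norm_eq_abs]
          refine intervalIntegral.norm_integral_le_of_norm_le hTt
            (ae_of_all _ fun u hu => ?_)
            ((hwc.mul continuous_const).intervalIntegrable _ _)
          have hφu := hT u hu.1.le
          rw [dist_zero_right] at hφu
          have hw : 0 ≤ a u * exp (∫ v in t₀..u, a v) := mul_nonneg (ha0 u) (exp_pos _).le
          rw [norm_mul, Real.norm_of_nonneg hw]
          exact mul_le_mul_of_nonneg_left hφu.le hw
      _ = (exp (∫ v in t₀..t, a v) - exp (∫ v in t₀..T, a v)) * (ε / 2) := by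
          rw [intervalIntegral.integral_mul_const, integral_mul_exp_primitive ha]
      _ ≤ ε / 2 * exp (∫ v in t₀..t, a v) := by
          nlinarith [exp_pos (∫ v in t₀..T, a v)]
  have hpos := exp_pos (-(∫ u in t₀..t, a u))
  have hone : exp (-(∫ u in t₀..t, a u)) * exp (∫ u in t₀..t, a u) = 1 := by
    rw [← exp_add, neg_add_cancel, exp_zero]
  simp only [Pi.mul_apply] at hsplit
  rw [← hsplit, abs_mul, abs_of_pos hpos]
  rw [abs_mul, abs_of_pos hpos, abs_abs] at hhead
  calc _ ≤ exp (-(∫ u in t₀..t, a u)) * (|C| + ε / 2 * exp (∫ v in t₀..t, a v)) :=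
        mul_le_mul_of_nonneg_left ((abs_add_le _ _).trans (by gcongr)) hpos.le
    _ = exp (-(∫ u in t₀..t, a u)) * |C| + ε / 2 := by
        linear_combination (ε / 2) * hone
    _ < ε := by linarith

/-- The pairing of an exponential average, centred at `c`, with a fixed vector is the
exponential average of the pairings. -/
theorem inner_exp_average_sub {H : Type*} [NormedAddCommGroup H] [InnerProductSpace ℝ H]
    [CompleteSpace H] {a : ℝ → ℝ} {y : ℝ → H} (ha : Continuous a) (hy : Continuous y)
    (t₀ t : ℝ) (c h : H) :
    ⟪exp (-(∫ u in t₀..t, a u)) • y t₀ + exp (-(∫ u in t₀..t, a u)) •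
        (∫ u in t₀..t, (a u * exp (∫ v in t₀..u, a v)) • y u) - c, h⟫ =
      exp (-(∫ u in t₀..t, a u)) * ⟪y t₀ - c, h⟫ + exp (-(∫ u in t₀..t, a u)) *
        ∫ u in t₀..t, a u * exp (∫ v in t₀..u, a v) * ⟪y u - c, h⟫ := by
  have hAc : Continuous (fun u => ∫ v in t₀..u, a v) :=
    intervalIntegral.continuous_primitive (fun _ _ => ha.intervalIntegrable _ _) t₀
  have hwc : Continuous (fun u => a u * exp (∫ v in t₀..u, a v)) :=
    ha.mul (continuous_exp.comp hAc)
  have hcomm : ∫ u in t₀..t, a u * exp (∫ v in t₀..u, a v) * ⟪y u, h⟫ =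
      ⟪∫ u in t₀..t, (a u * exp (∫ v in t₀..u, a v)) • y u, h⟫ := by
    have := (innerSL ℝ h).intervalIntegral_comp_comm
      ((hwc.smul hy).intervalIntegrable (μ := volume) t₀ t)
    simpa only [innerSL_apply_apply, Pi.smul_apply', inner_smul_right, real_inner_comm] using this
  have hsub : ∫ u in t₀..t, a u * exp (∫ v in t₀..u, a v) * ⟪y u - c, h⟫ =
      ⟪∫ u in t₀..t, (a u * exp (∫ v in t₀..u, a v)) • y u, h⟫ -
        (exp (∫ v in t₀..t, a v) - 1) * ⟪c, h⟫ := by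
    simp only [inner_sub_left, mul_sub]
    have hyc : Continuous (fun u => a u * exp (∫ v in t₀..u, a v) * ⟪y u, h⟫) :=
      hwc.mul (hy.inner continuous_const)
    have hcc : Continuous (fun u => a u * exp (∫ v in t₀..u, a v) * ⟪c, h⟫) :=
      hwc.mul continuous_const
    rw [intervalIntegral.integral_sub (hyc.intervalIntegrable _ _)
      (hcc.intervalIntegrable _ _), hcomm,
      intervalIntegral.integral_mul_const, integral_mul_exp_primitive ha,
      intervalIntegral.integral_same, exp_zero]
  have hone : exp (-(∫ u in t₀..t, a u)) * exp (∫ u in t₀..t, a u) = 1 := by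
    rw [← exp_add, neg_add_cancel, exp_zero]
  rw [hsub]
  simp only [inner_sub_left, inner_add_left, real_inner_smul_left]
  linear_combination ⟪c, h⟫ * hone

/-- Weak convergence transfer principle: if `y(t)` converges weakly to `x*`, `y` is bounded
and continuous, `‖ξ(t)‖ → 0`, and the averaging kernel `a ≥ 0` is nonintegrable
(`A(t) = ∫_{t₀}^t a → ∞`), then the exponential average
`x(t) = e^{-A(t)} y(t₀) + e^{-A(t)} ∫_{t₀}^t a(u) e^{A(u)} y(u) du + ξ(t)`
also converges weakly to `x*`. -/
theorem weak_convergence_of_average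
    {H : Type*} [NormedAddCommGroup H] [InnerProductSpace ℝ H] [CompleteSpace H]
    (t₀ : ℝ) (a : ℝ → ℝ) (ha : ContinuousOn a (Set.Ici t₀))
    (ha0 : ∀ u ≥ t₀, 0 ≤ a u)
    (hadiv : Filter.Tendsto (fun t => ∫ u in t₀..t, a u) Filter.atTop Filter.atTop)
    (y ξ x : ℝ → H) (hy : ContinuousOn y (Set.Ici t₀))
    (hybd : ∃ M, ∀ t ≥ t₀, ‖y t‖ ≤ M)
    (hξ : Filter.Tendsto (fun t => ‖ξ t‖) Filter.atTop (nhds 0))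
    (hx : ∀ t ≥ t₀,
      x t = Real.exp (-(∫ u in t₀..t, a u)) • y t₀ +
        Real.exp (-(∫ u in t₀..t, a u)) •
          (∫ u in t₀..t, (a u * Real.exp (∫ v in t₀..u, a v)) • y u) + ξ t)
    (xstar : H)
    (hweak : ∀ h : H, Filter.Tendsto (fun t => ⟪y t - xstar, h⟫) Filter.atTop (nhds 0)) :
    ∀ h : H, Filter.Tendsto (fun t => ⟪x t - xstar, h⟫) Filter.atTop (nhds 0) := by
  intro h
  have hcont : Continuous (fun u => max t₀ u) := continuous_const.max continuous_id
  have hmem : ∀ u, max t₀ u ∈ Set.Ici t₀ := fun u => Set.mem_Ici.2 (le_max_left _ _)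
  set b : ℝ → ℝ := fun u => a (max t₀ u) with hb
  set z : ℝ → H := fun u => y (max t₀ u) with hz
  have hbc : Continuous b := ha.comp_continuous hcont hmem
  have hzc : Continuous z := hy.comp_continuous hcont hmem
  have hba : ∀ u ≥ t₀, b u = a u := fun u hu => by simp only [hb, max_eq_right hu]
  have hzy : ∀ u ≥ t₀, z u = y u := fun u hu => by simp only [hz, max_eq_right hu]
  have hA : ∀ t ≥ t₀, ∫ u in t₀..t, b u = ∫ u in t₀..t, a u := fun t ht =>
    intervalIntegral.integral_congr fun u hu => hba u (Set.uIcc_of_le ht ▸ hu).1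
  have hI : ∀ t ≥ t₀, ∫ u in t₀..t, (b u * exp (∫ v in t₀..u, b v)) • z u =
      ∫ u in t₀..t, (a u * exp (∫ v in t₀..u, a v)) • y u := fun t ht =>
    intervalIntegral.integral_congr fun u hu => by
      have hu' : t₀ ≤ u := (Set.uIcc_of_le ht ▸ hu).1
      simp only [hba u hu', hzy u hu', hA u hu']
  have hbdiv : Tendsto (fun t => ∫ u in t₀..t, b u) atTop atTop :=
    hadiv.congr' ((eventually_ge_atTop t₀).mono fun t ht => (hA t ht).symm)
  have hφ : Tendsto (fun t => ⟪z t - xstar, h⟫) atTop (nhds 0) :=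
    (hweak h).congr' ((eventually_ge_atTop t₀).mono fun t ht => by simp only [hzy t ht])
  have havg := tendsto_exp_average_zero (φ := fun t => ⟪z t - xstar, h⟫) hbc
    (fun u => ha0 _ (hmem u)) t₀ hbdiv ((hzc.sub continuous_const).inner continuous_const) hφ
  have hinit := (tendsto_exp_neg_atTop_nhds_zero.comp hbdiv).mul_const ⟪z t₀ - xstar, h⟫
  have hnoise : Tendsto (fun t => ⟪ξ t, h⟫) atTop (nhds 0) := by
    simpa only [inner_zero_left] using
      (tendsto_zero_iff_norm_tendsto_zero.2 hξ).inner (tendsto_const_nhds (x := h))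
  have hsum := (hinit.add havg).add hnoise
  simp only [zero_mul, add_zero] at hsum
  refine hsum.congr' ((eventually_ge_atTop t₀).mono fun t ht => ?_)
  simp only [Function.comp_apply]
  rw [← inner_exp_average_sub hbc hzc, ← inner_add_left, hx t ht, hA t ht, hI t ht,
    hzy t₀ le_rfl, ← sub_add_eq_add_sub _ _ (ξ t)]
end

section
/- Let H be a real Hilbert space and f : H → ℝ a convex differentiable function whose gradient ∇f is L-Lipschitz and which attains its minimum min f. Let (Ω', Σ, μ) be a probability space, Y : Ω' → H Bochner integrable with f ∘ Y μ-integrable, ξ ∈ H, and set x = ∫ Y dμ + ξ. Then f(x) − min f ≤ (L‖x‖ + ‖∇f(0)‖)·‖ξ‖ + ∫ (f(Y(ω)) − min f) dμ(ω). -/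
open Filter MeasureTheory Real

/-- First-order characterization of convexity: a convex function lies above its tangents. -/
theorem ConvexOn.inner_gradient_le_sub {H : Type*} [NormedAddCommGroup H]
    [InnerProductSpace ℝ H] [CompleteSpace H] {f : H → ℝ} {g x : H}
    (hconv : ConvexOn ℝ Set.univ f) (hf : HasGradientAt f g x) (y : H) :
    inner ℝ g (y - x) ≤ f y - f x := by
  have hline : ConvexOn ℝ Set.univ (fun t : ℝ => f (AffineMap.lineMap x y t)) :=
    hconv.comp_affineMap (AffineMap.lineMap x y)
  have hderiv : HasDerivAt (fun t : ℝ => f (AffineMap.lineMap x y t))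
      (inner ℝ g (y - x)) 0 := by
    have hfx : HasFDerivAt f (InnerProductSpace.toDual ℝ H g)
        (AffineMap.lineMap x y (0 : ℝ)) := by
      simpa using hf.hasFDerivAt
    simpa [Function.comp_def] using hfx.comp_hasDerivAt (0 : ℝ) AffineMap.hasDerivAt_lineMap
  simpa [slope_def_field] using
    hline.le_slope_of_hasDerivAt (Set.mem_univ 0) (Set.mem_univ 1) zero_lt_one hderiv

/-- Key deterministic inequality for rates along the averaged trajectory: for `f` convex
with `L`-Lipschitz gradient attaining its minimum, a probability measure `μ`, a Bochner
integrable `Y` with `f ∘ Y` integrable, and `x = ∫ Y dμ + ξ`, one has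
`f(x) - min f ≤ (L‖x‖ + ‖∇f(0)‖)‖ξ‖ + ∫ (f(Y) - min f) dμ`. -/
theorem value_gap_of_average
    {H : Type*} [NormedAddCommGroup H] [InnerProductSpace ℝ H] [CompleteSpace H]
    (f : H → ℝ) (f' : H → H) (hconv : ConvexOn ℝ Set.univ f)
    (hf : ∀ z : H, HasGradientAt f (f' z) z)
    (L : ℝ) (hL : 0 ≤ L) (hLip : ∀ x y : H, ‖f' x - f' y‖ ≤ L * ‖x - y‖)
    (xmin : H) (hmin : ∀ z : H, f xmin ≤ f z)
    {Ω' : Type*} [MeasurableSpace Ω'] (μ : MeasureTheory.Measure Ω')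
    [MeasureTheory.IsProbabilityMeasure μ]
    (Y : Ω' → H) (hY : MeasureTheory.Integrable Y μ)
    (hfY : MeasureTheory.Integrable (fun ω => f (Y ω)) μ)
    (ξ x : H) (hx : x = (∫ ω, Y ω ∂μ) + ξ) :
    f x - f xmin ≤ (L * ‖x‖ + ‖f' 0‖) * ‖ξ‖ + ∫ ω, (f (Y ω) - f xmin) ∂μ := by
  have hcont : Continuous f := continuous_iff_continuousAt.2 fun z => (hf z).continuousAt
  have hjensen : f (∫ ω, Y ω ∂μ) ≤ ∫ ω, f (Y ω) ∂μ :=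
    hconv.map_integral_le hcont.continuousOn isClosed_univ (by simp) hY hfY
  have hint : ∫ ω, (f (Y ω) - f xmin) ∂μ = (∫ ω, f (Y ω) ∂μ) - f xmin := by
    rw [integral_sub hfY (integrable_const _)]
    simp
  have htangent := hconv.inner_gradient_le_sub (hf x) (∫ ω, Y ω ∂μ)
  have hsub : (∫ ω, Y ω ∂μ) - x = -ξ := by rw [hx]; abel
  rw [hsub, inner_neg_right] at htangent
  have hgrad : ‖f' x‖ ≤ L * ‖x‖ + ‖f' 0‖ := by
    have h := hLip x 0
    rw [sub_zero] at h
    linarith [norm_le_norm_sub_add (f' x) (f' 0)]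
  have hinner : inner ℝ (f' x) ξ ≤ (L * ‖x‖ + ‖f' 0‖) * ‖ξ‖ :=
    (real_inner_le_norm _ _).trans (by gcongr)
  linarith
end

section
/- Let H be a real Hilbert space, 0 < t₀, and α > 3. Let f : H → ℝ be convex and differentiable with L-Lipschitz gradient, attaining its minimum min f. Let y : [t₀,∞) → H be continuous and bounded with t²(f(y(t)) − min f) → 0 as t → ∞, and let ξ : [t₀,∞) → H satisfy sup_{t ≥ t₀} t^{α−1}‖ξ(t)‖ < ∞. Define x(t) = (t₀/t)^{α−1} y(t₀) + (α−1) t^{1−α} ∫_{t₀}^t u^{α−2} y(u) du + ξ(t). Then t²(f(x(t)) − min f) → 0 as t → ∞. -/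
open Filter MeasureTheory Real

theorem ConvexOn.add_inner_gradient_le {H : Type*} [NormedAddCommGroup H]
    [InnerProductSpace ℝ H] [CompleteSpace H] {f : H → ℝ} (hconv : ConvexOn ℝ Set.univ f)
    {x g : H} (hf : HasGradientAt f g x) (z : H) : f x + inner ℝ g (z - x) ≤ f z := by
  have hline : ConvexOn ℝ Set.univ (fun s : ℝ => f (AffineMap.lineMap x z s)) :=
    hconv.comp_affineMap (AffineMap.lineMap x z)
  have hx : HasFDerivAt f (InnerProductSpace.toDual ℝ H g) (AffineMap.lineMap x z (0 : ℝ)) := by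
    simpa using hf.hasFDerivAt
  have hderiv : HasDerivAt (fun s : ℝ => f (AffineMap.lineMap x z s)) (inner ℝ g (z - x)) 0 := by
    simpa using! hx.comp_hasDerivAt (0 : ℝ) (AffineMap.hasDerivAt_lineMap (a := x) (b := z))
  have hslope := hline.le_slope_of_hasDerivAt (Set.mem_univ _) (Set.mem_univ _) zero_lt_one hderiv
  simp only [slope_def_field, AffineMap.lineMap_apply_one, AffineMap.lineMap_apply_zero,
    sub_zero, div_one] at hslope
  linarith

/-- The average of `y` against the probability measure on `[a, t]` with density
`p * u ^ (p - 1) / t ^ p` and an atom of mass `(a / t) ^ p` at `a`. -/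
noncomputable def powAvg {E : Type*} [NormedAddCommGroup E] [NormedSpace ℝ E] (p a : ℝ)
    (y : ℝ → E) (t : ℝ) : E :=
  ((a / t) ^ p) • y a + (p * t ^ (-p)) • ∫ u in a..t, (u ^ (p - 1)) • y u

section PowAvg

variable {E : Type*} [NormedAddCommGroup E] [NormedSpace ℝ E] {p a t : ℝ}

theorem intervalIntegrable_rpow_smul {b : ℝ} (ha : 0 < a) (hab : a ≤ b) (hbt : b ≤ t) {y : ℝ → E}
    (hy : ContinuousOn y (Set.Ici a)) :
    IntervalIntegrable (fun u => (u ^ (p - 1)) • y u) volume b t := by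
  apply ContinuousOn.intervalIntegrable_of_Icc hbt
  refine ContinuousOn.smul (fun u hu => ?_) (hy.mono fun u hu => hab.trans hu.1)
  exact (Real.continuousAt_rpow_const u _
    (Or.inl (ha.trans_le (hab.trans hu.1)).ne')).continuousWithinAt

theorem integral_rpow_sub_one (hp : p ≠ 0) (ha : 0 < a) (hat : a ≤ t) :
    ∫ u in a..t, u ^ (p - 1) = (t ^ p - a ^ p) / p := by
  rw [integral_rpow (Or.inr ⟨fun h => hp (by linarith), ?_⟩), sub_add_cancel]
  rw [Set.uIcc_of_le hat]
  exact fun h => ha.not_ge h.1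

theorem powAvg_const [CompleteSpace E] (hp : p ≠ 0) (ha : 0 < a) (hat : a ≤ t) (c : E) :
    powAvg p a (fun _ => c) t = c := by
  have ht : 0 < t := ha.trans_le hat
  have htp : t ^ p ≠ 0 := (Real.rpow_pos_of_pos ht p).ne'
  rw [powAvg, intervalIntegral.integral_smul_const, integral_rpow_sub_one hp ha hat, smul_smul,
    ← add_smul, Real.div_rpow ha.le ht.le, Real.rpow_neg ht.le]
  convert one_smul ℝ c
  field_simp
  ring

theorem powAvg_add (ha : 0 < a) (hat : a ≤ t) {y z : ℝ → E}
    (hy : ContinuousOn y (Set.Ici a)) (hz : ContinuousOn z (Set.Ici a)) :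
    powAvg p a (fun u => y u + z u) t = powAvg p a y t + powAvg p a z t := by
  simp only [powAvg, smul_add]
  rw [intervalIntegral.integral_add (intervalIntegrable_rpow_smul ha le_rfl hat hy)
    (intervalIntegrable_rpow_smul ha le_rfl hat hz), smul_add]
  abel

theorem powAvg_clm_comp [CompleteSpace E] {F : Type*} [NormedAddCommGroup F] [NormedSpace ℝ F]
    [CompleteSpace F] (φ : E →L[ℝ] F) (ha : 0 < a) (hat : a ≤ t) {y : ℝ → E}
    (hy : ContinuousOn y (Set.Ici a)) :
    powAvg p a (fun u => φ (y u)) t = φ (powAvg p a y t) := by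
  simp only [powAvg, map_add, map_smul]
  rw [← φ.intervalIntegral_comp_comm (intervalIntegrable_rpow_smul ha le_rfl hat hy)]
  simp only [map_smul]

theorem powAvg_mono (hp : 0 ≤ p) (ha : 0 < a) (hat : a ≤ t) {φ ψ : ℝ → ℝ}
    (hφ : ContinuousOn φ (Set.Ici a)) (hψ : ContinuousOn ψ (Set.Ici a))
    (h : ∀ u ≥ a, φ u ≤ ψ u) : powAvg p a φ t ≤ powAvg p a ψ t := by
  have ht : 0 < t := ha.trans_le hat
  simp only [powAvg, smul_eq_mul]
  refine add_le_add (mul_le_mul_of_nonneg_left (h a le_rfl) (by positivity))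
    (mul_le_mul_of_nonneg_left ?_ (by positivity))
  refine intervalIntegral.integral_mono_on hat (intervalIntegrable_rpow_smul ha le_rfl hat hφ)
    (intervalIntegrable_rpow_smul ha le_rfl hat hψ) fun u hu => ?_
  exact mul_le_mul_of_nonneg_left (h u hu.1) (Real.rpow_nonneg (ha.le.trans hu.1) _)

theorem norm_powAvg_le (hp : 0 < p) (ha : 0 < a) (hat : a ≤ t) {y : ℝ → E} {M : ℝ}
    (h : ∀ u ≥ a, ‖y u‖ ≤ M) : ‖powAvg p a y t‖ ≤ M := by
  have ht : 0 < t := ha.trans_le hat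
  rw [← powAvg_const hp.ne' ha hat M]
  simp only [powAvg]
  refine (norm_add_le _ _).trans (add_le_add ?_ ?_)
  · rw [norm_smul, Real.norm_of_nonneg (by positivity), smul_eq_mul]
    exact mul_le_mul_of_nonneg_left (h a le_rfl) (by positivity)
  · rw [norm_smul, Real.norm_of_nonneg (by positivity), smul_eq_mul]
    refine mul_le_mul_of_nonneg_left ?_ (by positivity)
    refine intervalIntegral.norm_integral_le_of_norm_le hat (ae_of_all _ fun u hu => ?_)
      (intervalIntegrable_rpow_smul ha le_rfl hat continuousOn_const)
    have hu0 : 0 ≤ u := ha.le.trans hu.1.le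
    rw [norm_smul, Real.norm_of_nonneg (by positivity), smul_eq_mul]
    exact mul_le_mul_of_nonneg_left (h u hu.1.le) (by positivity)

theorem tendsto_rpow_neg_mul_integral_rpow_mul {q : ℝ} (hq : 0 < q) (ha : 0 < a) {h : ℝ → ℝ}
    (hc : ContinuousOn h (Set.Ici a)) (hlim : Tendsto h atTop (nhds 0)) :
    Tendsto (fun t => t ^ (-q) * ∫ u in a..t, u ^ (q - 1) * h u) atTop (nhds 0) := by
  rw [Metric.tendsto_nhds]
  intro ε hε
  obtain ⟨T, hT⟩ := eventually_atTop.1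
    ((Metric.tendsto_nhds.1 hlim (ε / 2 * q) (by positivity)).and (eventually_ge_atTop a))
  have haT : a ≤ T := (hT T le_rfl).2
  have hT0 : 0 < T := ha.trans_le haT
  have hK : Tendsto (fun t : ℝ => t ^ (-q) * |∫ u in a..T, u ^ (q - 1) * h u|) atTop (nhds 0) := by
    simpa using (tendsto_rpow_neg_atTop hq).mul_const |∫ u in a..T, u ^ (q - 1) * h u|
  filter_upwards [hK.eventually_lt_const (half_pos hε), eventually_ge_atTop T] with t htK hTt
  have ht : 0 < t := hT0.trans_le hTt
  have htail : |∫ u in T..t, u ^ (q - 1) * h u| ≤ ε / 2 * t ^ q := by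
    have hle : ‖∫ u in T..t, u ^ (q - 1) * h u‖ ≤ ∫ u in T..t, u ^ (q - 1) * (ε / 2 * q) := by
      refine intervalIntegral.norm_integral_le_of_norm_le hTt (ae_of_all _ fun u hu => ?_)
        (intervalIntegrable_rpow_smul hT0 le_rfl hTt continuousOn_const)
      have hu0 : 0 ≤ u := hT0.le.trans hu.1.le
      have hhu := (hT u hu.1.le).1
      rw [dist_zero_right] at hhu
      rw [norm_mul, Real.norm_of_nonneg (by positivity)]
      exact mul_le_mul_of_nonneg_left hhu.le (by positivity)
    rw [intervalIntegral.integral_mul_const, integral_rpow_sub_one hq.ne' hT0 hTt] at hle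
    refine hle.trans ?_
    have hTq : 0 ≤ T ^ q := by positivity
    have heq : (t ^ q - T ^ q) / q * (ε / 2 * q) = ε / 2 * (t ^ q - T ^ q) := by field_simp
    rw [heq]
    exact mul_le_mul_of_nonneg_left (by linarith) (by positivity)
  have hsplit : |∫ u in a..t, u ^ (q - 1) * h u| ≤
      |∫ u in a..T, u ^ (q - 1) * h u| + ε / 2 * t ^ q := by
    have hadd := intervalIntegral.integral_add_adjacent_intervals
      (intervalIntegrable_rpow_smul (p := q) ha le_rfl haT hc)
      (intervalIntegrable_rpow_smul ha haT hTt hc)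
    simp only [smul_eq_mul] at hadd
    rw [← hadd]
    exact (abs_add_le _ _).trans (add_le_add_right htail _)
  have hcancel : t ^ (-q) * (ε / 2 * t ^ q) = ε / 2 := by
    rw [Real.rpow_neg ht.le]
    field_simp
  rw [dist_zero_right, norm_mul, Real.norm_of_nonneg (by positivity), Real.norm_eq_abs]
  calc t ^ (-q) * |∫ u in a..t, u ^ (q - 1) * h u|
      ≤ t ^ (-q) * (|∫ u in a..T, u ^ (q - 1) * h u| + ε / 2 * t ^ q) :=
        mul_le_mul_of_nonneg_left hsplit (by positivity)
    _ < ε := by rw [mul_add, hcancel]; linarith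

theorem tendsto_sq_mul_powAvg (hp : 2 < p) (ha : 0 < a) {φ : ℝ → ℝ}
    (hc : ContinuousOn φ (Set.Ici a)) (hlim : Tendsto (fun t => t ^ 2 * φ t) atTop (nhds 0)) :
    Tendsto (fun t => t ^ 2 * powAvg p a φ t) atTop (nhds 0) := by
  have hq : 0 < p - 2 := by linarith
  have hatom := (tendsto_rpow_neg_atTop hq).mul_const (a ^ p * φ a)
  have hint := (tendsto_rpow_neg_mul_integral_rpow_mul hq ha
    ((continuousOn_id.pow 2).mul hc) hlim).const_mul p
  have hsum := hatom.add hint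
  simp only [zero_mul, mul_zero, add_zero] at hsum
  refine hsum.congr' ?_
  filter_upwards [eventually_ge_atTop a] with t hat
  have ht : 0 < t := ha.trans_le hat
  have hpow : t ^ (-(p - 2)) = t ^ 2 * t ^ (-p) := by
    rw [← Real.rpow_natCast t 2, ← Real.rpow_add ht]
    congr 1
    push_cast
    ring
  have hcongr : ∫ u in a..t, u ^ (p - 2 - 1) * (u ^ 2 * φ u) = ∫ u in a..t, u ^ (p - 1) * φ u := by
    refine intervalIntegral.integral_congr fun u hu => ?_
    rw [Set.uIcc_of_le hat] at hu
    have hu0 : 0 < u := ha.trans_le hu.1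
    rw [← mul_assoc, ← Real.rpow_natCast u 2, ← Real.rpow_add hu0]
    congr 2
    push_cast
    ring
  simp only [powAvg, smul_eq_mul, Pi.mul_apply, Pi.pow_apply, id_eq]
  rw [hcongr, hpow, Real.div_rpow ha.le ht.le, Real.rpow_neg ht.le]
  ring

end PowAvg

/-- Fast `o(1/t²)` rate transfer for the damping `γ(t) = α/t`, `α > 3`: if
`t²(f(y(t)) - min f) → 0`, `y` is bounded and continuous, `sup t^{α-1}‖ξ(t)‖ < ∞`, and
`x(t) = (t₀/t)^{α-1} y(t₀) + (α-1) t^{1-α} ∫_{t₀}^t u^{α-2} y(u) du + ξ(t)`, then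
`t²(f(x(t)) - min f) → 0`. -/
theorem fast_rate_transfer_alpha_over_t
    {H : Type*} [NormedAddCommGroup H] [InnerProductSpace ℝ H] [CompleteSpace H]
    (t₀ : ℝ) (ht₀ : 0 < t₀) (α : ℝ) (hα : 3 < α)
    (f : H → ℝ) (f' : H → H) (hconv : ConvexOn ℝ Set.univ f)
    (hf : ∀ z : H, HasGradientAt f (f' z) z)
    (L : ℝ) (hL : 0 ≤ L) (hLip : ∀ x y : H, ‖f' x - f' y‖ ≤ L * ‖x - y‖)
    (xmin : H) (hmin : ∀ z : H, f xmin ≤ f z)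
    (y ξ x : ℝ → H) (hy : ContinuousOn y (Set.Ici t₀))
    (hybd : ∃ M, ∀ t ≥ t₀, ‖y t‖ ≤ M)
    (hyrate : Filter.Tendsto (fun t => t ^ 2 * (f (y t) - f xmin)) Filter.atTop (nhds 0))
    (hξ : ∃ C, ∀ t ≥ t₀, t ^ (α - 1) * ‖ξ t‖ ≤ C)
    (hx : ∀ t ≥ t₀,
      x t = ((t₀ / t) ^ (α - 1)) • y t₀ +
        ((α - 1) * t ^ (1 - α)) • (∫ u in t₀..t, (u ^ (α - 2)) • y u) + ξ t) :
    Filter.Tendsto (fun t => t ^ 2 * (f (x t) - f xmin)) Filter.atTop (nhds 0) := by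
  have hp : 2 < α - 1 := by linarith
  have hp0 : 0 < α - 1 := by linarith
  obtain ⟨M, hM⟩ := hybd
  obtain ⟨C, hC⟩ := hξ
  have hfcont : Continuous f := continuous_iff_continuousAt.2 fun z => (hf z).continuousAt
  have hgap : ContinuousOn (fun u => f (y u) - f xmin) (Set.Ici t₀) :=
    (hfcont.comp_continuousOn hy).sub continuousOn_const
  have hxavg : ∀ t ≥ t₀, x t = powAvg (α - 1) t₀ y t + ξ t := fun t ht => by
    rw [hx t ht, powAvg, neg_sub, sub_sub]
    norm_num
  have hξle : ∀ t ≥ t₀, ‖ξ t‖ ≤ t ^ (-(α - 1)) * C := fun t ht => by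
    have ht0 : 0 < t := ht₀.trans_le ht
    rw [Real.rpow_neg ht0.le, ← div_eq_inv_mul, le_div_iff₀' (by positivity)]
    exact hC t ht
  have hC0 : 0 ≤ C := (by positivity : 0 ≤ t₀ ^ (α - 1) * ‖ξ t₀‖).trans (hC t₀ le_rfl)
  have hgrad : ∃ G, ∀ t ≥ t₀, ‖f' (x t)‖ ≤ G := by
    refine ⟨L * (M + t₀ ^ (-(α - 1)) * C + ‖xmin‖) + ‖f' xmin‖, fun t ht => ?_⟩
    have hpow : t ^ (-(α - 1)) ≤ t₀ ^ (-(α - 1)) :=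
      Real.rpow_le_rpow_of_nonpos ht₀ ht (by linarith)
    have hxle : ‖x t‖ ≤ M + t₀ ^ (-(α - 1)) * C := by
      rw [hxavg t ht]
      exact (norm_add_le _ _).trans (add_le_add (norm_powAvg_le hp0 ht₀ ht hM)
        ((hξle t ht).trans (mul_le_mul_of_nonneg_right hpow hC0)))
    calc ‖f' (x t)‖ ≤ ‖f' (x t) - f' xmin‖ + ‖f' xmin‖ := norm_le_norm_sub_add _ _
      _ ≤ _ := by
        gcongr
        exact (hLip _ _).trans (mul_le_mul_of_nonneg_left
          ((norm_sub_le _ _).trans (add_le_add_left hxle _)) hL)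
  obtain ⟨G, hG⟩ := hgrad
  have hupper : ∀ t ≥ t₀, f (x t) - f xmin ≤
      powAvg (α - 1) t₀ (fun u => f (y u) - f xmin) t + G * (t ^ (-(α - 1)) * C) := fun t ht => by
    have hjensen := powAvg_mono (ψ := fun u => f (y u) - f xmin)
      (φ := fun u => (f (x t) - f xmin - inner ℝ (f' (x t)) (x t)) + innerSL ℝ (f' (x t)) (y u))
      hp0.le ht₀ ht (continuousOn_const.add ((innerSL ℝ _).continuous.comp_continuousOn hy)) hgap
      fun u _ => by
        have := hconv.add_inner_gradient_le (hf (x t)) (y u)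
        rw [inner_sub_right] at this
        rw [innerSL_apply_apply]
        linarith
    rw [powAvg_add (z := fun u => innerSL ℝ (f' (x t)) (y u)) ht₀ ht continuousOn_const
        ((innerSL ℝ _).continuous.comp_continuousOn hy),
      powAvg_const hp0.ne' ht₀ ht, powAvg_clm_comp _ ht₀ ht hy, innerSL_apply_apply] at hjensen
    have hinner : inner ℝ (f' (x t)) (x t) =
        inner ℝ (f' (x t)) (powAvg (α - 1) t₀ y t) + inner ℝ (f' (x t)) (ξ t) := by
      rw [← inner_add_right, ← hxavg t ht]
    have hbound : inner ℝ (f' (x t)) (ξ t) ≤ G * (t ^ (-(α - 1)) * C) :=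
      (real_inner_le_norm _ _).trans (mul_le_mul (hG t ht) (hξle t ht) (norm_nonneg _)
        ((norm_nonneg _).trans (hG t ht)))
    linarith
  have herr : Tendsto (fun t : ℝ => t ^ 2 * (G * (t ^ (-(α - 1)) * C))) atTop (nhds 0) := by
    have hlim := (tendsto_rpow_neg_atTop (sub_pos.2 hp)).mul_const (G * C)
    rw [zero_mul] at hlim
    refine hlim.congr' ?_
    filter_upwards [eventually_gt_atTop 0] with t ht
    have hpow : t ^ (-(α - 1 - 2)) = t ^ 2 * t ^ (-(α - 1)) := by
      rw [← Real.rpow_natCast t 2, ← Real.rpow_add ht]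
      congr 1
      push_cast
      ring
    rw [hpow]
    ring
  have hmajor := (tendsto_sq_mul_powAvg hp ht₀ hgap hyrate).add herr
  rw [add_zero] at hmajor
  refine squeeze_zero' (Eventually.of_forall fun t =>
    mul_nonneg (sq_nonneg t) (sub_nonneg.2 (hmin _))) ?_ hmajor
  filter_upwards [eventually_ge_atTop t₀] with t ht
  rw [← mul_add]
  exact mul_le_mul_of_nonneg_left (hupper t ht) (sq_nonneg t)
end

section
/- Let t₀ > 0. Given a continuous function γ : [t₀,∞) → [0,∞), define p(t) = exp(∫_{t₀}^t γ(s)ds) and, assuming ∫_{t₀}^∞ ds/p(s) < ∞, define Γ(t) = p(t)∫_t^∞ ds/p(s). Then ∫_{t₀}^∞ ds/Γ(s) = +∞. -/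
open Filter MeasureTheory Real

/-- The tail integral of an integrable continuous function is differentiable, with derivative
minus the function. -/
lemma hasDerivAt_integral_Ici {f : ℝ → ℝ} {a t : ℝ} (hc : ContinuousOn f (Set.Ioi a))
    (hint : IntegrableOn f (Set.Ici a)) (ht : a < t) :
    HasDerivAt (fun u => ∫ s in Set.Ici u, f s) (-f t) t := by
  have hint' : IntegrableOn f (Set.Ioi a) := hint.mono_set Set.Ioi_subset_Ici_self
  have hd : HasDerivAt (fun u => ∫ s in a..u, f s) (f t) t :=
    intervalIntegral.integral_hasDerivAt_right
      ((intervalIntegrable_iff_integrableOn_Ioc_of_le ht.le).2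
        (hint'.mono_set Set.Ioc_subset_Ioi_self))
      (hc.stronglyMeasurableAtFilter isOpen_Ioi t ht) (hc.continuousAt (Ioi_mem_nhds ht))
  refine (hd.const_sub (∫ s in Set.Ioi a, f s)).congr_of_eventuallyEq ?_
  filter_upwards [Ioi_mem_nhds ht] with u hu
  rw [integral_Ici_eq_integral_Ioi, ← intervalIntegral.integral_Ioi_sub_Ioi hint' (le_of_lt hu)]
  ring

/-- The tail integral of an integrable function tends to zero. -/
lemma tendsto_integral_Ici_atTop {f : ℝ → ℝ} {a : ℝ} (hint : IntegrableOn f (Set.Ici a)) :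
    Tendsto (fun u => ∫ s in Set.Ici u, f s) atTop (nhds 0) := by
  have hint' : IntegrableOn f (Set.Ioi a) := hint.mono_set Set.Ioi_subset_Ici_self
  have h := (intervalIntegral_tendsto_integral_Ioi a hint' tendsto_id).const_sub
    (∫ s in Set.Ioi a, f s)
  rw [sub_self] at h
  refine h.congr' ?_
  filter_upwards [eventually_ge_atTop a] with u hu
  rw [integral_Ici_eq_integral_Ioi, id, ← intervalIntegral.integral_Ioi_sub_Ioi hint' hu]
  ring

/-- The tail integral of an integrable positive function is positive. -/
lemma integral_Ici_pos {f : ℝ → ℝ} {a t : ℝ} (hpos : ∀ s, 0 < f s)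
    (hint : IntegrableOn f (Set.Ici a)) (ht : a ≤ t) : 0 < ∫ s in Set.Ici t, f s := by
  rw [setIntegral_pos_iff_support_of_nonneg_ae (ae_of_all _ fun s => (hpos s).le)
    (hint.mono_set (Set.Ici_subset_Ici.2 ht))]
  have : Function.support f = Set.univ := Set.eq_univ_of_forall fun s => (hpos s).ne'
  simp [this]

/-- The quotient of a positive integrable continuous function by its tail integral is not
integrable. -/
lemma not_integrableOn_div_integral_Ici {f : ℝ → ℝ} {a : ℝ} (hc : ContinuousOn f (Set.Ioi a))
    (hpos : ∀ s, 0 < f s) (hint : IntegrableOn f (Set.Ici a)) :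
    ¬ IntegrableOn (fun t => f t / ∫ s in Set.Ici t, f s) (Set.Ioi a) := by
  have hd : ∀ t, a < t → HasDerivAt (fun u => log (∫ s in Set.Ici u, f s))
      (-f t / ∫ s in Set.Ici t, f s) t := fun t ht =>
    (hasDerivAt_integral_Ici hc hint ht).log (integral_Ici_pos hpos hint ht.le).ne'
  refine not_integrableOn_of_tendsto_norm_atTop_of_deriv_isBigO_filter
    (f := fun u => log (∫ s in Set.Ici u, f s)) atTop (Ioi_mem_atTop a) ?_ ?_ ?_
  · filter_upwards [eventually_gt_atTop a] with t ht using (hd t ht).differentiableAt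
  · refine tendsto_abs_atBot_atTop.comp (tendsto_log_nhdsGT_zero.comp ?_)
    refine tendsto_nhdsWithin_iff.2 ⟨tendsto_integral_Ici_atTop hint, ?_⟩
    filter_upwards [eventually_ge_atTop a] with t ht using integral_Ici_pos hpos hint ht
  · refine Asymptotics.IsBigO.of_bound 1 ?_
    filter_upwards [eventually_gt_atTop a] with t ht
    rw [(hd t ht).deriv, neg_div, norm_neg, one_mul]

/-- Lemma A.3 of the paper: with `p(t) = exp(∫_{t₀}^t γ)` and
`Γ(t) = p(t) ∫_t^∞ ds/p(s)` (assuming `∫_{t₀}^∞ ds/p(s) < ∞`), the function `1/Γ` is not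
integrable on `[t₀,∞)`: `∫_{t₀}^∞ ds/Γ(s) = +∞`. -/
theorem one_over_Gamma_not_integrable
    (t₀ : ℝ) (ht₀ : 0 < t₀) (γ : ℝ → ℝ)
    (hγc : ContinuousOn γ (Set.Ici t₀)) (hγ0 : ∀ t ≥ t₀, 0 ≤ γ t)
    (p Γ : ℝ → ℝ)
    (hp : ∀ t, p t = Real.exp (∫ s in t₀..t, γ s))
    (hpint : MeasureTheory.IntegrableOn (fun s => 1 / p s) (Set.Ici t₀))
    (hΓ : ∀ t, Γ t = p t * ∫ s in Set.Ici t, 1 / p s) :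
    ∫⁻ s in Set.Ici t₀, ENNReal.ofReal (1 / Γ s) = ⊤ := by
  have hp_pos : ∀ t, 0 < p t := fun t => hp t ▸ exp_pos _
  have hinv_pos : ∀ t, 0 < 1 / p t := fun t => one_div_pos.2 (hp_pos t)
  have hp_cont : ContinuousOn p (Set.Ioi t₀) := fun t ht => by
    have hd : HasDerivAt (fun u => ∫ s in t₀..u, γ s) (γ t) t :=
      intervalIntegral.integral_hasDerivAt_right
        (hγc.mono ((Set.uIcc_of_le (Set.mem_Ioi.1 ht).le).trans_subset
          Set.Icc_subset_Ici_self)).intervalIntegrable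
        ((hγc.mono Set.Ioi_subset_Ici_self).stronglyMeasurableAtFilter isOpen_Ioi t ht)
        (hγc.continuousAt (Ici_mem_nhds ht))
    rw [funext hp]
    exact hd.exp.continuousAt.continuousWithinAt
  have hinv_cont : ContinuousOn (fun t => 1 / p t) (Set.Ioi t₀) :=
    continuousOn_const.div hp_cont fun t _ => (hp_pos t).ne'
  have hΓ_eq : (fun t => 1 / Γ t) = fun t => 1 / p t / ∫ s in Set.Ici t, 1 / p s := by
    funext t
    rw [hΓ, div_div]
  have hq_pos : ∀ t ∈ Set.Ioi t₀, 0 < ∫ s in Set.Ici t, 1 / p s := fun t ht =>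
    integral_Ici_pos hinv_pos hpint (le_of_lt ht)
  have hΓ_cont : ContinuousOn (fun t => 1 / Γ t) (Set.Ioi t₀) := by
    rw [hΓ_eq]
    exact hinv_cont.div (fun t ht =>
      (hasDerivAt_integral_Ici hinv_cont hpint ht).continuousAt.continuousWithinAt)
      fun t ht => (hq_pos t ht).ne'
  have hΓ_nonneg : 0 ≤ᵐ[volume.restrict (Set.Ioi t₀)] fun t => 1 / Γ t := by
    filter_upwards [ae_restrict_mem measurableSet_Ioi] with t ht
    exact congrFun hΓ_eq t ▸ (div_pos (hinv_pos t) (hq_pos t ht)).le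
  rw [← setLIntegral_congr (Ioi_ae_eq_Ici (μ := volume) (a := t₀))]
  by_contra hfin
  refine not_integrableOn_div_integral_Ici hinv_cont hinv_pos hpint ?_
  rw [← hΓ_eq]
  exact (lintegral_ofReal_ne_top_iff_integrable
    (hΓ_cont.aestronglyMeasurable measurableSet_Ioi) hΓ_nonneg).1 hfin
end

section
/- Let t₀ > 0. Given a continuous function γ : [t₀,∞) → [0,∞), define p(t) = exp(∫_{t₀}^t γ(s)ds) and, assuming ∫_{t₀}^∞ ds/p(s) < ∞, define Γ(t) = p(t)∫_t^∞ ds/p(s). If moreover there is a nonincreasing function g : [t₀,∞) → ℝ with γ(t) ≤ g(t) for all t ≥ t₀, then Γ(t) ≥ e^{−g(t₀)} > 0 for every t ≥ t₀, and consequently ∫_{t₀}^∞ Γ(u)du = +∞. -/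
open Filter MeasureTheory Real

/-- Over a window of length at most one, `exp (∫ γ)` grows by a factor of at most `exp C`
when `0 ≤ γ ≤ C`. -/
theorem exp_neg_le_exp_integral_div {t₀ C : ℝ} {γ : ℝ → ℝ}
    (hγc : ContinuousOn γ (Set.Ici t₀)) (hγ0 : ∀ t ≥ t₀, 0 ≤ γ t) (hγC : ∀ t ≥ t₀, γ t ≤ C)
    {t s : ℝ} (ht : t₀ ≤ t) (hts : t ≤ s) (hst : s ≤ t + 1) :
    Real.exp (-C) ≤ Real.exp (∫ u in t₀..t, γ u) * (1 / Real.exp (∫ u in t₀..s, γ u)) := by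
  have hint : ∀ a b, t₀ ≤ a → a ≤ b → IntervalIntegrable γ volume a b := fun a b ha hab =>
    (hγc.mono fun x hx => ha.trans (Set.uIcc_of_le hab ▸ hx).1).intervalIntegrable
  have hC : 0 ≤ C := (hγ0 t ht).trans (hγC t ht)
  have hadd := intervalIntegral.integral_add_adjacent_intervals
    (hint t₀ t le_rfl ht) (hint t s ht hts)
  have hle : ∫ u in t..s, γ u ≤ ∫ _ in t..s, C :=
    intervalIntegral.integral_mono_on hts (hint t s ht hts) intervalIntegrable_const
      fun x hx => hγC x (ht.trans hx.1)
  rw [intervalIntegral.integral_const, smul_eq_mul] at hle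
  rw [one_div, ← Real.exp_neg, ← Real.exp_add, Real.exp_le_exp]
  nlinarith

/-- Under hypothesis (H_γ) — `γ` nonnegative and bounded above by a nonincreasing
function `g` — the function `Γ(t) = p(t) ∫_t^∞ ds/p(s)` is bounded below by the positive
constant `e^{-g(t₀)}`, and consequently `∫_{t₀}^∞ Γ(u) du = +∞`. -/
theorem Gamma_lower_bound_and_nonintegrable
    (t₀ : ℝ) (ht₀ : 0 < t₀) (γ : ℝ → ℝ)
    (hγc : ContinuousOn γ (Set.Ici t₀)) (hγ0 : ∀ t ≥ t₀, 0 ≤ γ t)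
    (p Γ : ℝ → ℝ)
    (hp : ∀ t, p t = Real.exp (∫ s in t₀..t, γ s))
    (hpint : MeasureTheory.IntegrableOn (fun s => 1 / p s) (Set.Ici t₀))
    (hΓ : ∀ t, Γ t = p t * ∫ s in Set.Ici t, 1 / p s)
    (g : ℝ → ℝ) (hg : AntitoneOn g (Set.Ici t₀)) (hγg : ∀ t ≥ t₀, γ t ≤ g t) :
    (∀ t ≥ t₀, Real.exp (-(g t₀)) ≤ Γ t) ∧ 0 < Real.exp (-(g t₀)) ∧
      ∫⁻ u in Set.Ici t₀, ENNReal.ofReal (Γ u) = ⊤ := by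
  have hbound : ∀ t ≥ t₀, Real.exp (-(g t₀)) ≤ Γ t := by
    intro t ht
    have hint : IntegrableOn (fun s => p t * (1 / p s)) (Set.Ici t) :=
      (hpint.mono_set (Set.Ici_subset_Ici.2 ht)).const_mul (p t)
    have hnonneg : ∀ s, 0 ≤ p t * (1 / p s) := fun s => by
      rw [hp, hp]
      positivity
    calc Real.exp (-(g t₀)) = ∫ _ in Set.Icc t (t + 1), Real.exp (-(g t₀)) := by simp
      _ ≤ ∫ s in Set.Icc t (t + 1), p t * (1 / p s) := by
        refine setIntegral_mono_on (by simp) (hint.mono_set Set.Icc_subset_Ici_self)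
          measurableSet_Icc fun s hs => ?_
        rw [hp, hp]
        exact exp_neg_le_exp_integral_div hγc hγ0
          (fun u hu => (hγg u hu).trans (hg Set.self_mem_Ici hu hu)) ht hs.1 hs.2
      _ ≤ ∫ s in Set.Ici t, p t * (1 / p s) :=
        setIntegral_mono_set hint (ae_of_all _ hnonneg) Set.Icc_subset_Ici_self.eventuallyLE
      _ = Γ t := by rw [hΓ, integral_const_mul]
  refine ⟨hbound, Real.exp_pos _, eq_top_iff.2 ?_⟩
  calc (⊤ : ENNReal) = ∫⁻ _ in Set.Ici t₀, ENNReal.ofReal (Real.exp (-(g t₀))) := by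
        rw [setLIntegral_const, Real.volume_Ici, ENNReal.mul_top]
        simpa using Real.exp_pos _
    _ ≤ ∫⁻ u in Set.Ici t₀, ENNReal.ofReal (Γ u) :=
        setLIntegral_mono' measurableSet_Ici fun u hu => ENNReal.ofReal_le_ofReal (hbound u hu)
end

section
/- Let t₀ > 0. Given a continuous function γ : [t₀,∞) → [0,∞), define p(t) = exp(∫_{t₀}^t γ(s)ds) and, assuming ∫_{t₀}^∞ ds/p(s) < ∞, define Γ(t) = p(t)∫_t^∞ ds/p(s), and set A(t) = ∫_{t₀}^t du/Γ(u). Let h : [t₀,∞) → [0,∞) be measurable and bounded with h(t) → 0 as t → ∞. Then I[h](t) := e^{−A(t)} ∫_{t₀}^t h(u) · (e^{A(u)}/Γ(u)) du → 0 as t → ∞. -/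
open Filter MeasureTheory Real

/-- A weighted average of `h` with weight `w = B'`, where `B → ∞`, tends to `0` if `h` does. -/
theorem tendsto_inv_mul_integral_mul_deriv {a : ℝ} {B w h : ℝ → ℝ}
    (hB : ContinuousOn B (Set.Ici a)) (hBw : ∀ t > a, HasDerivAt B (w t) t)
    (hw : ContinuousOn w (Set.Ici a)) (hw0 : ∀ t ≥ a, 0 ≤ w t) (hBtop : Tendsto B atTop atTop)
    (hmeas : Measurable h) (h0 : ∀ t ≥ a, 0 ≤ h t) (hbd : ∃ M, ∀ t ≥ a, h t ≤ M)
    (hlim : Tendsto h atTop (nhds 0)) :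
    Tendsto (fun t => (B t)⁻¹ * ∫ u in a..t, h u * w u) atTop (nhds 0) := by
  obtain ⟨M, hM⟩ := hbd
  have int_w : ∀ s ≥ a, ∀ t ≥ s, IntervalIntegrable w volume s t := fun s hs t hst =>
    (hw.mono fun x hx =>
      hs.le.trans (by rw [Set.uIcc_of_le hst] at hx; exact hx.1)).intervalIntegrable
  have int_hw : ∀ s ≥ a, ∀ t ≥ s, IntervalIntegrable (fun u => h u * w u) volume s t := by
    intro s hs t hst
    have hi := int_w s hs t hst
    rw [intervalIntegrable_iff_integrableOn_Ioc_of_le hst] at hi ⊢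
    refine (hi.const_mul M).mono' (hmeas.aestronglyMeasurable.mul hi.aestronglyMeasurable) ?_
    refine (ae_restrict_iff' measurableSet_Ioc).2 (Eventually.of_forall fun u hu => ?_)
    have hu' : a ≤ u := hs.le.trans hu.1.le
    rw [Real.norm_of_nonneg (mul_nonneg (h0 u hu') (hw0 u hu'))]
    exact mul_le_mul_of_nonneg_right (hM u hu') (hw0 u hu')
  rw [Metric.tendsto_atTop']
  intro ε hε
  obtain ⟨s, hs⟩ := eventually_atTop.1
    ((hlim.eventually (gt_mem_nhds (half_pos hε))).and (eventually_ge_atTop a))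
  have hsa : a ≤ s := (hs s le_rfl).2
  set C := (∫ u in a..s, h u * w u) + ε / 2 * |B s| with hC
  obtain ⟨N, hN⟩ := eventually_atTop.1
    ((hBtop.eventually_gt_atTop (max 0 (C / (ε / 2)))).and (eventually_ge_atTop s))
  refine ⟨N, fun t ht => ?_⟩
  obtain ⟨hBt, hst⟩ := hN t ht.le
  have hBpos : 0 < B t := (le_max_left _ _).trans_lt hBt
  have hCB : C < ε / 2 * B t := by
    have := (div_lt_iff₀ (half_pos hε)).1 ((le_max_right _ _).trans_lt hBt)
    linarith
  have hat : a ≤ t := hsa.trans hst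
  have hnonneg : 0 ≤ ∫ u in a..t, h u * w u :=
    intervalIntegral.integral_nonneg hat fun u hu => mul_nonneg (h0 u hu.1) (hw0 u hu.1)
  have hsplit := intervalIntegral.integral_add_adjacent_intervals
    (int_hw a le_rfl s hsa) (int_hw s hsa t hst)
  have hftc : ∫ u in s..t, w u = B t - B s :=
    intervalIntegral.integral_eq_sub_of_hasDerivAt_of_le hst
      (hB.mono fun x hx => hsa.trans hx.1) (fun x hx => hBw x (hsa.trans_lt hx.1))
      (int_w s hsa t hst)
  have htail : ∫ u in s..t, h u * w u ≤ ε / 2 * (B t - B s) := by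
    rw [← hftc, ← intervalIntegral.integral_const_mul]
    exact intervalIntegral.integral_mono_on hst (int_hw s hsa t hst)
      ((int_w s hsa t hst).const_mul _) fun u hu =>
        mul_le_mul_of_nonneg_right (hs u hu.1).1.le (hw0 u (hsa.trans hu.1))
  have hBs : -(ε / 2 * B s) ≤ ε / 2 * |B s| := by
    rw [← mul_neg]
    exact mul_le_mul_of_nonneg_left (neg_le_abs _) (half_pos hε).le
  rw [Real.dist_0_eq_abs, abs_of_nonneg (mul_nonneg (inv_pos.2 hBpos).le hnonneg),
    inv_mul_lt_iff₀ hBpos]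
  linarith

/-- The primitive, based at `a`, of a function continuous on `[a, ∞)`. -/
theorem hasDerivAt_integral_of_continuousOn_Ici {a t : ℝ} {f : ℝ → ℝ}
    (hf : ContinuousOn f (Set.Ici a)) (ht : a < t) :
    HasDerivAt (fun x => ∫ u in a..x, f u) (f t) t := by
  refine intervalIntegral.integral_hasDerivAt_right
    (hf.mono fun x hx => ?_).intervalIntegrable
    ((hf.mono Set.Ioi_subset_Ici_self).stronglyMeasurableAtFilter isOpen_Ioi t ht)
    (hf.continuousAt (Ici_mem_nhds ht))
  rw [Set.uIcc_of_le ht.le] at hx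
  exact hx.1

theorem continuousOn_integral_of_continuousOn_Ici {a : ℝ} {f : ℝ → ℝ}
    (hf : ContinuousOn f (Set.Ici a)) :
    ContinuousOn (fun x => ∫ u in a..x, f u) (Set.Ici a) := by
  intro t ht
  have hcont : ContinuousOn (fun x => ∫ u in a..x, f u) (Set.Icc a (t + 1)) := by
    have hat : a ≤ t + 1 := le_add_of_le_of_nonneg ht zero_le_one
    have := intervalIntegral.continuousOn_primitive_interval (μ := volume) (f := f) (a := a)
      (b := t + 1) (by
        rw [Set.uIcc_of_le hat]
        exact (hf.mono fun x hx => hx.1).integrableOn_Icc)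
    rwa [Set.uIcc_of_le hat] at this
  refine (hcont t ⟨ht, by linarith⟩).mono_of_mem_nhdsWithin ?_
  rw [← Set.Ici_inter_Iic]
  exact Filter.inter_mem self_mem_nhdsWithin
    (mem_nhdsWithin_of_mem_nhds (Iic_mem_nhds (by linarith)))

/-- The quantity `I[h](t) = e^{-A(t)} ∫_{t₀}^t h(u) e^{A(u)}/Γ(u) du`, with
`A(t) = ∫_{t₀}^t du/Γ(u)` and `Γ` built from the viscous damping `γ`, tends to `0` as
`t → ∞` whenever `h` is measurable, nonnegative, bounded and `h(t) → 0`. -/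
theorem I_of_h_tendsto_zero
    (t₀ : ℝ) (ht₀ : 0 < t₀) (γ : ℝ → ℝ)
    (hγc : ContinuousOn γ (Set.Ici t₀)) (hγ0 : ∀ t ≥ t₀, 0 ≤ γ t)
    (p Γ A : ℝ → ℝ)
    (hp : ∀ t, p t = Real.exp (∫ s in t₀..t, γ s))
    (hpint : MeasureTheory.IntegrableOn (fun s => 1 / p s) (Set.Ici t₀))
    (hΓ : ∀ t, Γ t = p t * ∫ s in Set.Ici t, 1 / p s)
    (hA : ∀ t, A t = ∫ u in t₀..t, 1 / Γ u)
    (h : ℝ → ℝ) (hmeas : Measurable h) (h0 : ∀ t ≥ t₀, 0 ≤ h t)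
    (hbd : ∃ M, ∀ t ≥ t₀, h t ≤ M)
    (hlim : Filter.Tendsto h Filter.atTop (nhds 0)) :
    Filter.Tendsto
      (fun t => Real.exp (-(A t)) * ∫ u in t₀..t, h u * (Real.exp (A u) / Γ u))
      Filter.atTop (nhds 0) := by
  set T : ℝ → ℝ := fun t => ∫ s in Set.Ici t, 1 / p s with hT
  have hp_pos : ∀ t, 0 < p t := fun t => hp t ▸ Real.exp_pos _
  have hp_cont : ContinuousOn p (Set.Ici t₀) :=
    (Real.continuous_exp.comp_continuousOn (continuousOn_integral_of_continuousOn_Ici hγc)).congr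
      fun t _ => hp t
  have hq_cont : ContinuousOn (fun t => 1 / p t) (Set.Ici t₀) :=
    continuousOn_const.div hp_cont fun t _ => (hp_pos t).ne'
  have hT_split : ∀ s ≥ t₀, ∀ t ≥ s, T s = (∫ u in s..t, 1 / p u) + T t := by
    intro s hs t hst
    simp only [hT, integral_Ici_eq_integral_Ioi]
    rw [← intervalIntegral.integral_Ioi_sub_Ioi
      (hpint.mono_set fun x hx => hs.le.trans (le_of_lt hx)) hst, sub_add_cancel]
  have hT_eq : ∀ t ≥ t₀, T t = T t₀ - ∫ u in t₀..t, 1 / p u := fun t ht => by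
    linarith [hT_split t₀ le_rfl t ht]
  have hT_pos : ∀ t ≥ t₀, 0 < T t := by
    intro t ht
    rw [hT_split t ht (t + 1) (by linarith)]
    refine add_pos_of_pos_of_nonneg ?_
      (setIntegral_nonneg measurableSet_Ici fun u _ => (one_div_pos.2 (hp_pos u)).le)
    refine intervalIntegral.intervalIntegral_pos_of_pos_on
      (hq_cont.mono fun x hx => ?_).intervalIntegrable
      (fun u _ => one_div_pos.2 (hp_pos u)) (by linarith)
    rw [Set.uIcc_of_le (by linarith)] at hx
    exact ht.le.trans hx.1
  have hT_cont : ContinuousOn T (Set.Ici t₀) :=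
    (continuousOn_const.sub (continuousOn_integral_of_continuousOn_Ici hq_cont)).congr hT_eq
  have hT_deriv : ∀ t > t₀, HasDerivAt T (-(1 / p t)) t := fun t ht =>
    ((hasDerivAt_integral_of_continuousOn_Ici hq_cont ht).const_sub (T t₀)).congr_of_eventuallyEq
      ((eventually_ge_nhds ht).mono hT_eq)
  have hT_lim : Tendsto T atTop (nhdsWithin 0 (Set.Ioi 0)) := by
    refine tendsto_nhdsWithin_iff.2 ⟨?_, (eventually_ge_atTop t₀).mono hT_pos⟩
    have hQ := intervalIntegral_tendsto_integral_Ioi t₀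
      (hpint.mono_set Set.Ioi_subset_Ici_self) tendsto_id
    rw [← integral_Ici_eq_integral_Ioi] at hQ
    have := hQ.const_sub (T t₀)
    rw [show T t₀ - ∫ s in Set.Ici t₀, 1 / p s = 0 from sub_self _] at this
    exact this.congr' ((eventually_ge_atTop t₀).mono fun t ht => (hT_eq t ht).symm)
  have hΓ_pos : ∀ t ≥ t₀, 0 < Γ t := fun t ht => by
    rw [hΓ]
    exact mul_pos (hp_pos t) (hT_pos t ht)
  have hΓ_cont : ContinuousOn Γ (Set.Ici t₀) := (hp_cont.mul hT_cont).congr fun t _ => hΓ t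
  have hA_eq : ∀ t ≥ t₀, A t = Real.log (T t₀) - Real.log (T t) := by
    intro t ht
    have hcont : ContinuousOn (fun x => -Real.log (T x)) (Set.Icc t₀ t) :=
      ((hT_cont.mono fun x hx => hx.1).log fun x hx => (hT_pos x hx.1).ne').neg
    have hderiv : ∀ x ∈ Set.Ioo t₀ t, HasDerivAt (fun x => -Real.log (T x)) (1 / Γ x) x := by
      intro x hx
      have hTx := (hT_pos x hx.1.le).ne'
      have hpx := (hp_pos x).ne'
      refine ((hT_deriv x hx.1).log hTx).neg.congr_deriv ?_
      rw [hΓ]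
      change _ = 1 / (p x * T x)
      field_simp
    rw [hA, intervalIntegral.integral_eq_sub_of_hasDerivAt_of_le ht hcont hderiv
      (ContinuousOn.intervalIntegrable ?_)]
    · ring
    · rw [Set.uIcc_of_le ht]
      exact continuousOn_const.div (hΓ_cont.mono fun x hx => hx.1) fun x hx => (hΓ_pos x hx.1).ne'
  have hexpA : ∀ t ≥ t₀, Real.exp (A t) = T t₀ / T t := fun t ht => by
    rw [hA_eq t ht, Real.exp_sub, Real.exp_log (hT_pos t₀ le_rfl), Real.exp_log (hT_pos t ht)]
  have hexpA_cont : ContinuousOn (fun t => Real.exp (A t)) (Set.Ici t₀) :=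
    (continuousOn_const.div hT_cont fun t ht => (hT_pos t ht).ne').congr hexpA
  have hexpA_deriv : ∀ t > t₀,
      HasDerivAt (fun t => Real.exp (A t)) (Real.exp (A t) / Γ t) t := by
    intro t ht
    have hTt := (hT_pos t ht.le).ne'
    have hpt := (hp_pos t).ne'
    refine (((hasDerivAt_const t (T t₀)).div (hT_deriv t ht) hTt).congr_of_eventuallyEq
      ((eventually_ge_nhds ht).mono hexpA)).congr_deriv ?_
    rw [hexpA t ht.le, hΓ]
    change _ = T t₀ / T t / (p t * T t)
    field_simp
    ring
  have hexpA_top : Tendsto (fun t => Real.exp (A t)) atTop atTop :=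
    ((tendsto_inv_nhdsGT_zero.comp hT_lim).const_mul_atTop (hT_pos t₀ le_rfl)).congr'
      ((eventually_ge_atTop t₀).mono fun t ht => (hexpA t ht).symm)
  simp only [Real.exp_neg]
  exact tendsto_inv_mul_integral_mul_deriv hexpA_cont hexpA_deriv
    (hexpA_cont.div hΓ_cont fun t ht => (hΓ_pos t ht).ne')
    (fun t ht => div_nonneg (Real.exp_pos _).le (hΓ_pos t ht).le) hexpA_top hmeas h0 hbd hlim
end

section
/- Let 0 < t₀ < t₁ and α > 3. Then there exists a constant C > 0 such that for all t ≥ t₁: t^{1−α} ∫_{t₁}^t u^{α−2}/(u² − t₀²) du ≤ C t^{−2}. -/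
open Filter MeasureTheory Real

theorem sq_div_sq_sub_sq_le {a b u : ℝ} (ha : 0 < a) (hab : a < b) (hbu : b ≤ u) :
    u ^ 2 / (u ^ 2 - a ^ 2) ≤ b ^ 2 / (b ^ 2 - a ^ 2) := by
  have hb : 0 < b ^ 2 - a ^ 2 := by nlinarith
  have hu : b ^ 2 ≤ u ^ 2 := by nlinarith
  rw [div_le_div_iff₀ (by linarith) hb]
  nlinarith [mul_le_mul_of_nonneg_left hu (sq_nonneg a)]

/-- Quantitative core of the estimate `I[1/θ](t) = O(t^{1-α} + t^{-2})` in the case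
`γ(t) = α/t`: for `0 < t₀ < t₁` and `α > 3`, there is `C > 0` with
`t^{1-α} ∫_{t₁}^t u^{α-2}/(u² - t₀²) du ≤ C t^{-2}` for all `t ≥ t₁`. -/
theorem integral_estimate_alpha_over_t
    (t₀ t₁ : ℝ) (h0 : 0 < t₀) (h01 : t₀ < t₁) (α : ℝ) (hα : 3 < α) :
    ∃ C > 0, ∀ t ≥ t₁,
      t ^ (1 - α) * ∫ u in t₁..t, u ^ (α - 2) / (u ^ 2 - t₀ ^ 2) ≤ C / t ^ 2 := by
  have hd : 0 < t₁ ^ 2 - t₀ ^ 2 := by nlinarith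
  have ht₁ : 0 < t₁ := h0.trans h01
  have hα' : 0 < α - 3 := by linarith
  set K := t₁ ^ 2 / (t₁ ^ 2 - t₀ ^ 2)
  have hK0 : 0 < K := by positivity
  refine ⟨K / (α - 3), by positivity, fun t ht => ?_⟩
  have ht0 : 0 < t := ht₁.trans_le ht
  have h_int : IntervalIntegrable (fun u : ℝ => u ^ (α - 2) / (u ^ 2 - t₀ ^ 2)) volume t₁ t := by
    apply ContinuousOn.intervalIntegrable_of_Icc ht
    refine ContinuousOn.div ?_ (by fun_prop) ?_
    · exact continuousOn_id.rpow_const fun _ _ => Or.inr (by linarith)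
    · intro u hu
      have := hu.1
      nlinarith
  have h_le : ∫ u in t₁..t, u ^ (α - 2) / (u ^ 2 - t₀ ^ 2) ≤ K * (t ^ (α - 3) / (α - 3)) := by
    calc ∫ u in t₁..t, u ^ (α - 2) / (u ^ 2 - t₀ ^ 2)
        ≤ ∫ u in t₁..t, K * u ^ (α - 4) := by
          refine intervalIntegral.integral_mono_on ht h_int
            ((intervalIntegral.intervalIntegrable_rpow' (by linarith)).const_mul K) fun u hu => ?_
          have hu0 : 0 < u := ht₁.trans_le hu.1
          have h_split : u ^ (α - 2) = u ^ 2 * u ^ (α - 4) := by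
            rw [← rpow_natCast, ← rpow_add hu0]
            congr 1
            push_cast
            ring
          rw [h_split, mul_div_right_comm]
          exact mul_le_mul_of_nonneg_right (sq_div_sq_sub_sq_le h0 h01 hu.1) (by positivity)
      _ = K * ((t ^ (α - 3) - t₁ ^ (α - 3)) / (α - 3)) := by
          rw [intervalIntegral.integral_const_mul, integral_rpow (Or.inl (by linarith))]
          ring_nf
      _ ≤ K * (t ^ (α - 3) / (α - 3)) := by
          gcongr
          exact sub_le_self _ (by positivity)
  have h_pow : t ^ (1 - α) * t ^ (α - 3) = (t ^ 2)⁻¹ := by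
    rw [← rpow_add ht0, ← rpow_natCast, ← rpow_neg ht0.le]
    congr 1
    push_cast
    ring
  calc t ^ (1 - α) * ∫ u in t₁..t, u ^ (α - 2) / (u ^ 2 - t₀ ^ 2)
      ≤ t ^ (1 - α) * (K * (t ^ (α - 3) / (α - 3))) := by gcongr
    _ = K / (α - 3) * (t ^ (1 - α) * t ^ (α - 3)) := by ring
    _ = K / (α - 3) / t ^ 2 := by rw [h_pow, ← div_eq_mul_inv]
end

section
/- Let t₀ ∈ ℝ, c > 0, λ ∈ (0,1), ŝ ≥ 0, and set t̂ = cŝ + t₀ and θ(u) = (u − t₀)/c. Let l : [ŝ,∞) → [0,∞) be measurable and nonincreasing with ∫_{ŝ}^∞ l(u)du ≤ C_∞ < ∞. Then for every t > t̂: e^{−ct} ∫_{t̂}^t l(ŝ + λ(θ(u) − ŝ)) e^{cu} du ≤ (c/λ) C_∞ e^{c(t̂ − t)/2} + (1/c) · l(ŝ + λ((t + t̂ − 2t₀)/(2c) − ŝ)). -/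
open Filter MeasureTheory Real

theorem AntitoneOn.integral_mul_exp_le {g : ℝ → ℝ} {a m b c : ℝ} (hc : 0 < c) (ham : a ≤ m)
    (hmb : m ≤ b) (hg : AntitoneOn g (Set.Icc a b)) (h0 : ∀ u ∈ Set.Icc a b, 0 ≤ g u) :
    ∫ u in a..b, g u * Real.exp (c * u)
      ≤ Real.exp (c * m) * (∫ u in a..m, g u) + g m * (Real.exp (c * b) / c) := by
  have hexp : Continuous fun u : ℝ => Real.exp (c * u) := by fun_prop
  have hgam : IntervalIntegrable g volume a m :=
    AntitoneOn.intervalIntegrable <| hg.mono <| by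
      rw [Set.uIcc_of_le ham]; exact Set.Icc_subset_Icc_right hmb
  have hgmb : IntervalIntegrable g volume m b :=
    AntitoneOn.intervalIntegrable <| hg.mono <| by
      rw [Set.uIcc_of_le hmb]; exact Set.Icc_subset_Icc_left ham
  have hIam := hgam.mul_continuousOn hexp.continuousOn
  have hImb := hgmb.mul_continuousOn hexp.continuousOn
  have hleft : ∫ u in a..m, g u * Real.exp (c * u) ≤ Real.exp (c * m) * ∫ u in a..m, g u := by
    rw [← intervalIntegral.integral_const_mul]
    refine intervalIntegral.integral_mono_on ham hIam (hgam.const_mul _) fun u hu => ?_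
    rw [mul_comm]
    have := h0 u ⟨hu.1, hu.2.trans hmb⟩
    have := hu.2
    gcongr
  have hright : ∫ u in m..b, g u * Real.exp (c * u) ≤ g m * (Real.exp (c * b) / c) := by
    calc ∫ u in m..b, g u * Real.exp (c * u)
        ≤ ∫ u in m..b, g m * Real.exp (c * u) := by
          refine intervalIntegral.integral_mono_on hmb hImb
            ((hexp.const_mul _).intervalIntegrable _ _) fun u hu => ?_
          have := hg ⟨ham, hmb⟩ ⟨ham.trans hu.1, hu.2⟩ hu.1
          gcongr
      _ = g m * ((Real.exp (c * b) - Real.exp (c * m)) / c) := by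
          rw [intervalIntegral.integral_const_mul,
            intervalIntegral.integral_comp_mul_left Real.exp hc.ne', integral_exp, smul_eq_mul,
            inv_mul_eq_div]
      _ ≤ g m * (Real.exp (c * b) / c) := by
          have := h0 m ⟨ham, hmb⟩
          have := Real.exp_pos (c * m)
          gcongr
          linarith
  rw [← intervalIntegral.integral_add_adjacent_intervals hIam hImb]
  exact add_le_add hleft hright

theorem integral_comp_mul_sub_add_le {l : ℝ → ℝ} {s a m k : ℝ} (hk : 0 < k) (ham : a ≤ m)
    (hl0 : ∀ u ≥ s, 0 ≤ l u) (hl : IntegrableOn l (Set.Ici s)) :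
    ∫ u in a..m, l (k * u + (s - k * a)) ≤ k⁻¹ * ∫ u in Set.Ici s, l u := by
  rw [intervalIntegral.integral_comp_mul_add l hk.ne', smul_eq_mul, add_sub_cancel,
    intervalIntegral.integral_of_le (by nlinarith)]
  gcongr
  · exact ae_restrict_of_forall_mem measurableSet_Ici hl0
  · exact Set.Ioc_subset_Ioi_self.trans Set.Ioi_subset_Ici_self

/-- Integral splitting estimate used in the local linear rate under the
Polyak–Łojasiewicz inequality: for `l ≥ 0` nonincreasing and integrable on `[ŝ,∞)` with
`∫_{ŝ}^∞ l ≤ C_∞`, `t̂ = cŝ + t₀`, `θ(u) = (u - t₀)/c`, one has for all `t > t̂`: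
`e^{-ct} ∫_{t̂}^t l(ŝ + λ(θ(u) - ŝ)) e^{cu} du
  ≤ (c/λ) C_∞ e^{c(t̂-t)/2} + (1/c) l(ŝ + λ((t + t̂ - 2t₀)/(2c) - ŝ))`. -/
theorem pl_integral_splitting
    (t₀ c lam shat : ℝ) (hc : 0 < c) (hlam0 : 0 < lam) (hlam1 : lam < 1)
    (hshat : 0 ≤ shat)
    (l : ℝ → ℝ) (hlmeas : Measurable l) (hl0 : ∀ u ≥ shat, 0 ≤ l u)
    (hlmono : AntitoneOn l (Set.Ici shat))
    (hlint : MeasureTheory.IntegrableOn l (Set.Ici shat))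
    (Cinf : ℝ) (hC : ∫ u in Set.Ici shat, l u ≤ Cinf) :
    ∀ t > c * shat + t₀,
      Real.exp (-(c * t)) *
        ∫ u in (c * shat + t₀)..t, l (shat + lam * ((u - t₀) / c - shat)) * Real.exp (c * u)
      ≤ (c / lam) * Cinf * Real.exp (c * ((c * shat + t₀) - t) / 2) +
        (1 / c) * l (shat + lam * ((t + (c * shat + t₀) - 2 * t₀) / (2 * c) - shat)) := by
  intro t ht
  set a := c * shat + t₀ with ha
  have ham : a ≤ (t + a) / 2 := by linarith
  have hmb : (t + a) / 2 ≤ t := by linarith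
  have hk : 0 < lam / c := by positivity
  have harg : ∀ u, shat + lam * ((u - t₀) / c - shat) = lam / c * u + (shat - lam / c * a) := by
    intro u
    rw [ha]
    field_simp
    ring
  have hmem : ∀ u, a ≤ u → shat ≤ lam / c * u + (shat - lam / c * a) := by
    intro u hu
    have := mul_le_mul_of_nonneg_left hu hk.le
    linarith
  have hmid : (t + a - 2 * t₀) / (2 * c) = ((t + a) / 2 - t₀) / c := by
    field_simp
  simp only [hmid, harg]
  have hsplit := AntitoneOn.integral_mul_exp_le
    (g := fun u => l (lam / c * u + (shat - lam / c * a))) hc ham hmb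
    (fun u hu v hv huv => hlmono (hmem u hu.1) (hmem v hv.1) (by gcongr))
    (fun u hu => hl0 _ (hmem u hu.1))
  have hhead := integral_comp_mul_sub_add_le hk ham hl0 hlint
  rw [inv_div] at hhead
  have hexp : Real.exp (-(c * t)) * Real.exp (c * ((t + a) / 2)) = Real.exp (c * (a - t) / 2) := by
    rw [← Real.exp_add]
    ring_nf
  have hexp' : Real.exp (-(c * t)) * Real.exp (c * t) = 1 := by
    rw [← Real.exp_add, neg_add_cancel, Real.exp_zero]
  calc _ ≤ Real.exp (-(c * t)) * (Real.exp (c * ((t + a) / 2)) * (c / lam * Cinf) +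
        l (lam / c * ((t + a) / 2) + (shat - lam / c * a)) * (Real.exp (c * t) / c)) := by
        have hbound := hhead.trans (mul_le_mul_of_nonneg_left hC (by positivity))
        refine mul_le_mul_of_nonneg_left (hsplit.trans ?_) (Real.exp_pos _).le
        gcongr
    _ = c / lam * Cinf * (Real.exp (-(c * t)) * Real.exp (c * ((t + a) / 2))) +
        Real.exp (-(c * t)) * Real.exp (c * t) / c *
          l (lam / c * ((t + a) / 2) + (shat - lam / c * a)) := by ring
    _ = _ := by rw [hexp, hexp']
end
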